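/- For any t ∈ [0,1] one has (ρ/R)^s · t^s ≤ μ([0,t]) ≤ t^s and (ρ/R)^s · (1−t)^s ≤ μ([t,1]) ≤ (1−t)^s. -/

import Mathlib

open MeasureTheory Filter Set Topology ENNReal

namespace HomogeneousCantorDensity

noncomputable def R (N : ℕ) (ρ : ℝ) : ℝ := (1 - ρ) / ((N : ℝ) - 1)

noncomputable def f (N : ℕ) (ρ : ℝ) (i : ℕ) (x : ℝ) : ℝ := ρ * x + (i : ℝ) * R N ρ

noncomputable def piMap (N : ℕ) (ρ : ℝ) (d : ℕ → ℕ) : ℝ :=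
  R N ρ * ∑' i : ℕ, (d i : ℝ) * ρ ^ i

def cantorE (N : ℕ) (ρ : ℝ) : Set ℝ :=
  {x | ∃ d : ℕ → ℕ, (∀ i, d i < N) ∧ x = piMap N ρ d}

/-- `μ = ∑_{i=0}^{N-1} (1/N) μ ∘ f_i⁻¹`. -/
def IsSelfSimilar (N : ℕ) (ρ : ℝ) (μ : Measure ℝ) : Prop :=
  μ = ∑ i ∈ Finset.range N, (N : ℝ≥0∞)⁻¹ • μ.map (f N ρ i)

/-- `T^n x` for `x = piMap N ρ d`. -/
noncomputable def Tn (N : ℕ) (ρ : ℝ) (d : ℕ → ℕ) (n : ℕ) : ℝ :=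
  piMap N ρ (fun i => d (n + i))

/-- pointwise lower `s`-density of `μ` at `x`. -/
noncomputable def lowerDensity (μ : Measure ℝ) (s x : ℝ) : ℝ :=
  liminf (fun r : ℝ => (μ (Ioo (x - r) (x + r))).toReal / (2 * r) ^ s) (𝓝[>] 0)

/-- pointwise upper `s`-density of `μ` at `x`. -/
noncomputable def upperDensity (μ : Measure ℝ) (s x : ℝ) : ℝ :=
  limsup (fun r : ℝ => (μ (Ioo (x - r) (x + r))).toReal / (2 * r) ^ s) (𝓝[>] 0)

lemma s_facts (N : ℕ) (hN : 2 ≤ N) (ρ : ℝ) (hρ0 : 0 < ρ)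
    (hρ1 : ρ ≤ 1 / (N : ℝ) ^ 2) (s : ℝ) (hs : s = -Real.log N / Real.log ρ) :
    0 < s ∧ s ≤ 1 ∧ ρ ^ s = 1 / N ∧ ρ * N < 1 := by
  have hN' : (2 : ℝ) ≤ N := by exact_mod_cast hN
  have hρN : ρ * N < 1 := by
    rw [le_div_iff₀ (by positivity)] at hρ1
    nlinarith [mul_pos hρ0 (by linarith : (0 : ℝ) < N)]
  have hρlt : ρ < 1 := by nlinarith
  have hl : Real.log ρ < 0 := Real.log_neg hρ0 hρlt
  have hLN : 0 < Real.log N := Real.log_pos (by linarith)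
  have hsum : Real.log ρ + Real.log N < 0 := by
    rw [← Real.log_mul hρ0.ne' (by positivity)]
    exact Real.log_neg (by positivity) hρN
  refine ⟨?_, ?_, ?_, hρN⟩
  · rw [hs]; exact div_pos_of_neg_of_neg (by linarith) hl
  · rw [hs, div_le_one_of_neg hl]; linarith
  · rw [Real.rpow_def_of_pos hρ0, hs, mul_div_cancel₀ _ hl.ne, Real.exp_neg,
      Real.exp_log (by linarith), one_div]

lemma pow_swap (s B u : ℝ) (hs0 : 0 < s) (hs1 : s ≤ 1) (hB : 0 < B) (hu0 : 0 ≤ u) (hu1 : u ≤ 1) :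
    u ^ s + (B + 1) ^ s ≤ 1 + (B + u) ^ s := by
  have hc := Real.concaveOn_rpow hs0.le hs1
  have hD : 0 < B + 1 - u := by linarith
  have hab : B / (B + 1 - u) + (1 - u) / (B + 1 - u) = 1 := by field_simp; ring
  have ha : 0 ≤ B / (B + 1 - u) := by positivity
  have hb : 0 ≤ (1 - u) / (B + 1 - u) := div_nonneg (by linarith) hD.le
  have h1 := hc.2 (x := u) hu0 (y := B + 1) (by simp; linarith) ha hb hab
  have h2 := hc.2 (x := u) hu0 (y := B + 1) (by simp; linarith) hb ha (by linarith)
  simp only [smul_eq_mul] at h1 h2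
  have e1 : B / (B + 1 - u) * u + (1 - u) / (B + 1 - u) * (B + 1) = 1 := by field_simp; ring
  have e2 : (1 - u) / (B + 1 - u) * u + B / (B + 1 - u) * (B + 1) = B + u := by field_simp; ring
  rw [e1, Real.one_rpow] at h1
  rw [e2] at h2
  have : (B / (B + 1 - u) + (1 - u) / (B + 1 - u)) * (u ^ s + (B + 1) ^ s) ≤ 1 + (B + u) ^ s := by
    linarith
  rwa [hab, one_mul] at this

lemma upper_ineq (n : ℝ) (hn : 0 < n) (A s : ℝ) (hA : 0 < A) (hs0 : 0 < s) (hs1 : s ≤ 1)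
    (h : (n * A + 1) ^ s = n + 1) (k u : ℝ) (hk0 : 0 ≤ k) (hk : k ≤ n) (hu0 : 0 ≤ u)
    (hu1 : u ≤ 1) : k + u ^ s ≤ (k * A + u) ^ s := by
  have h1 := pow_swap s (n * A) u hs0 hs1 (by positivity) hu0 hu1
  rw [h] at h1
  have hc := Real.concaveOn_rpow hs0.le hs1
  have hb : 0 ≤ 1 - k / n := by
    rw [sub_nonneg, div_le_one hn]; exact hk
  have ha : 0 ≤ k / n := by positivity
  have h2 := hc.2 (x := n * A + u) (by simp; positivity) (y := u) hu0 ha hb (by ring)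
  simp only [smul_eq_mul] at h2
  have e : k / n * (n * A + u) + (1 - k / n) * u = k * A + u := by field_simp; ring
  rw [e] at h2
  have h3 : k / n * (n + u ^ s) ≤ k / n * (n * A + u) ^ s :=
    mul_le_mul_of_nonneg_left (by linarith) ha
  have e3 : k / n * (n + u ^ s) = k + k / n * u ^ s := by field_simp
  linarith

lemma iio_zero (N : ℕ) (hN : 2 ≤ N) (ρ : ℝ) (hρ0 : 0 < ρ) (hρ1 : ρ < 1)
    (μ : Measure ℝ) (hprob : IsProbabilityMeasure μ)
    (hR : 0 < R N ρ)
    (hF : ∀ t, μ.real (Iic t) = (1 / N) * ∑ i ∈ Finset.range N, μ.real (Iic ((t - i * R N ρ) / ρ))) :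
    ∀ t < 0, μ.real (Iic t) = 0 := by
  have hN' : (2 : ℝ) ≤ N := by exact_mod_cast hN
  have step : ∀ t, μ.real (Iic t) ≤ μ.real (Iic (t / ρ)) := by
    intro t
    rw [hF t]
    have : ∑ i ∈ Finset.range N, μ.real (Iic ((t - i * R N ρ) / ρ)) ≤
        ∑ i ∈ Finset.range N, μ.real (Iic (t / ρ)) := by
      apply Finset.sum_le_sum
      intro i _
      refine measureReal_mono ?_ (measure_ne_top _ _)
      apply Iic_subset_Iic.2
      gcongr
      have : 0 ≤ (i : ℝ) * R N ρ := by positivity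
      linarith
    rw [Finset.sum_const, Finset.card_range, nsmul_eq_mul] at this
    rw [one_div, inv_mul_le_iff₀ (by positivity)]
    exact this
  intro t ht
  have it : ∀ n : ℕ, μ.real (Iic t) ≤ μ.real (Iic (t * (1 / ρ) ^ n)) := by
    intro n
    induction n with
    | zero => simp
    | succ n ih =>
      refine ih.trans ((step _).trans (le_of_eq ?_))
      congr 2
      rw [pow_succ]; field_simp
  have l1 : Tendsto (fun n : ℕ => t * (1 / ρ) ^ n) atTop atBot :=
    (tendsto_pow_atTop_atTop_of_one_lt ((one_lt_div hρ0).2 hρ1)).const_mul_atTop_of_neg ht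
  have l2 : Tendsto (fun x : ℝ => μ.real (Iic x)) atBot (𝓝 0) := by
    have := ProbabilityTheory.tendsto_cdf_atBot μ
    exact this.congr (fun x => ProbabilityTheory.cdf_eq_real μ x)
  exact le_antisymm (ge_of_tendsto' (l2.comp l1) it) measureReal_nonneg

lemma cdf_eq (N : ℕ) (ρ : ℝ) (hρ0 : 0 < ρ)
    (μ : Measure ℝ) (hprob : IsProbabilityMeasure μ) (hss : IsSelfSimilar N ρ μ) (t : ℝ) :
    μ.real (Iic t) = (1 / N) * ∑ i ∈ Finset.range N, μ.real (Iic ((t - i * R N ρ) / ρ)) := by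
  have hm : ∀ i, Measurable (f N ρ i) := by intro i; unfold f; fun_prop
  have h : μ (Iic t) = (∑ i ∈ Finset.range N, (N : ℝ≥0∞)⁻¹ • μ.map (f N ρ i)) (Iic t) :=
    congrArg (fun m : Measure ℝ => m (Iic t)) hss
  have e : ∀ i : ℕ, (μ.map (f N ρ i)) (Iic t) = μ (Iic ((t - i * R N ρ) / ρ)) := by
    intro i
    rw [Measure.map_apply (hm i) measurableSet_Iic]
    congr 1
    ext x
    simp only [mem_preimage, mem_Iic, f]
    rw [le_div_iff₀ hρ0]
    constructor <;> intro h <;> linarith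
  rw [Measure.finsetSum_apply] at h
  simp only [Measure.smul_apply, e, smul_eq_mul] at h
  rw [← Finset.mul_sum] at h
  rw [measureReal_def, h, ENNReal.toReal_mul, ENNReal.toReal_sum (fun i _ => measure_ne_top _ _)]
  simp [measureReal_def]

lemma reflect_ss (N : ℕ) (hN : 2 ≤ N) (ρ : ℝ)
    (μ : Measure ℝ) (hss : IsSelfSimilar N ρ μ) :
    IsSelfSimilar N ρ (μ.map (fun x : ℝ => 1 - x)) := by
  have hN' : (2 : ℝ) ≤ N := by exact_mod_cast hN
  have hm : ∀ i, Measurable (f N ρ i) := by intro i; unfold f; fun_prop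
  have hg : Measurable (fun x : ℝ => 1 - x) := by fun_prop
  have hRN : ((N : ℝ) - 1) * R N ρ = 1 - ρ := by
    unfold R; field_simp [(by linarith : (N : ℝ) - 1 ≠ 0)]
  unfold IsSelfSimilar
  have h : μ.map (fun x : ℝ => 1 - x) =
      (∑ i ∈ Finset.range N, (N : ℝ≥0∞)⁻¹ • μ.map (f N ρ i)).map (fun x : ℝ => 1 - x) :=
    congrArg (fun m : Measure ℝ => m.map (fun x : ℝ => 1 - x)) hss
  refine h.trans ?_
  ext S hS
  rw [Measure.map_apply hg hS, Measure.finsetSum_apply, Measure.finsetSum_apply,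
    ← Finset.sum_range_reflect]
  apply Finset.sum_congr rfl
  intro i hi
  have hi' := Finset.mem_range.1 hi
  have hc : ((N - 1 - i : ℕ) : ℝ) = (N : ℝ) - 1 - i := by
    rw [Nat.cast_sub (by omega), Nat.cast_sub (by omega)]; simp
  rw [Measure.smul_apply, Measure.smul_apply, Measure.map_apply (hm _) (hg hS),
    Measure.map_apply (hm _) hS, Measure.map_apply hg (hm _ hS)]
  congr 2
  ext x
  simp only [mem_preimage, f, hc]
  have e : 1 - (ρ * x + ((N : ℝ) - 1 - i) * R N ρ) = ρ * (1 - x) + i * R N ρ := by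
    linear_combination -hRN
  rw [e]

lemma half_bounds (N : ℕ) (hN : 2 ≤ N) (ρ : ℝ) (hρ0 : 0 < ρ)
    (hρ1 : ρ ≤ 1 / (N : ℝ) ^ 2) (s : ℝ) (hs : s = -Real.log N / Real.log ρ)
    (μ : Measure ℝ) (hprob : IsProbabilityMeasure μ) (hss : IsSelfSimilar N ρ μ)
    (t : ℝ) (ht : t ∈ Icc (0 : ℝ) 1) :
    (ρ / R N ρ) ^ s * t ^ s ≤ (μ (Icc 0 t)).toReal ∧
    (μ (Icc 0 t)).toReal ≤ t ^ s := by
  obtain ⟨hs0, hs1, hρs, hρN⟩ := s_facts N hN ρ hρ0 hρ1 s hs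
  have hN' : (2 : ℝ) ≤ N := by exact_mod_cast hN
  have hρlt : ρ < 1 := by nlinarith
  have hN1 : 0 < (N : ℝ) - 1 := by linarith
  have hRN : ((N : ℝ) - 1) * R N ρ = 1 - ρ := by
    unfold R; field_simp
  have hRρ : ρ < R N ρ := by
    unfold R; rw [lt_div_iff₀ hN1]; linarith
  have hR : 0 < R N ρ := hρ0.trans hRρ
  have hF := cdf_eq N ρ hρ0 μ hprob hss
  have hneg := iio_zero N hN ρ hρ0 hρlt μ hprob hR hF
  have hm : Measurable (fun x : ℝ => 1 - x) := by fun_prop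
  have hprob' : IsProbabilityMeasure (μ.map (fun x : ℝ => 1 - x)) :=
    Measure.isProbabilityMeasure_map hm.aemeasurable
  have hneg' := iio_zero N hN ρ hρ0 hρlt _ hprob' hR
    (cdf_eq N ρ hρ0 _ hprob' (reflect_ss N hN ρ μ hss))
  have hgt : ∀ t, 1 < t → μ.real (Iic t) = 1 := by
    intro t ht
    have h := hneg' (1 - t) (by linarith)
    rw [measureReal_def, Measure.map_apply hm measurableSet_Iic] at h
    have e : (fun x : ℝ => 1 - x) ⁻¹' (Iic (1 - t)) = Ici t := by
      ext x; simp
    rw [e] at h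
    have h2 : μ.real (Iic t)ᶜ = 0 := by
      refine le_antisymm ?_ measureReal_nonneg
      rw [← h]
      refine measureReal_mono ?_ (measure_ne_top _ _)
      intro x hx
      simp only [mem_compl_iff, mem_Iic, not_le] at hx
      exact hx.le
    rw [probReal_compl_eq_one_sub measurableSet_Iic] at h2
    linarith
  have h0 : μ (Iio 0) = 0 := by
    have : Iio (0 : ℝ) = ⋃ n : ℕ, Iic (-(1 / ((n : ℝ) + 1))) := by
      ext x
      simp only [mem_Iio, mem_iUnion, mem_Iic]
      constructor
      · intro hx
        obtain ⟨n, hn⟩ := exists_nat_one_div_lt (neg_pos.2 hx)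
        exact ⟨n, by linarith⟩
      · rintro ⟨n, hn⟩
        have : 0 < 1 / ((n : ℝ) + 1) := by positivity
        linarith
    rw [this, measure_iUnion_null_iff]
    intro n
    have h := hneg (-(1 / ((n : ℝ) + 1))) (neg_neg_of_pos (by positivity))
    rwa [measureReal_def, ENNReal.toReal_eq_zero_iff, or_iff_left (measure_ne_top _ _)] at h
  have hIcc : (μ (Icc 0 t)).toReal = μ.real (Iic t) := by
    rw [measureReal_def]
    congr 1
    apply le_antisymm (measure_mono (fun x hx => hx.2))
    calc μ (Iic t) ≤ μ (Icc 0 t ∪ Iio 0) := by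
          apply measure_mono
          intro x hx
          rcases lt_or_ge x 0 with h | h
          · exact Or.inr h
          · exact Or.inl ⟨h, hx⟩
      _ ≤ μ (Icc 0 t) + μ (Iio 0) := measure_union_le _ _
      _ = μ (Icc 0 t) := by rw [h0, add_zero]
  rw [hIcc]
  generalize hFdef : (fun x => μ.real (Iic x)) = F at *
  have hFx : ∀ x, μ.real (Iic x) = F x := fun x => by rw [← hFdef]
  have hle1 : ∀ x, F x ≤ 1 := fun x => by rw [← hFx]; exact measureReal_le_one
  have hnn : ∀ x, 0 ≤ F x := fun x => by rw [← hFx]; exact measureReal_nonneg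
  simp only [hFx] at hF hneg hgt ⊢
  clear hneg' hprob' hFx hFdef hIcc h0
  set A : ℝ := R N ρ / ρ with hA
  have hA1 : 1 < A := (one_lt_div hρ0).2 hRρ
  have hAρ : A * ρ = R N ρ := by rw [hA]; field_simp
  -- the functional equation
  have key : ∀ t, 0 ≤ t → t ≤ 1 → ∃ k : ℕ, ∃ u : ℝ, k + 1 ≤ N ∧ 0 ≤ u ∧ u ≤ A ∧
      t = ρ * (k * A + u) ∧ F t = (k + F u) / N := by
    intro t ht0 ht1
    have hk1 := Nat.floor_le (div_nonneg ht0 hR.le)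
    have hk2 := Nat.lt_floor_add_one (t / R N ρ)
    set k := ⌊t / R N ρ⌋₊
    rw [le_div_iff₀ hR] at hk1
    rw [div_lt_iff₀ hR] at hk2
    have hkN : k < N := by
      have : (k : ℝ) < N := by
        by_contra hcon
        push Not at hcon
        have := mul_le_mul_of_nonneg_right hcon hR.le
        linarith
      exact_mod_cast this
    have htu : t = ρ * (k * A + (t - k * R N ρ) / ρ) := by
      rw [hA]; field_simp; ring
    refine ⟨k, (t - k * R N ρ) / ρ, hkN, div_nonneg (by linarith) hρ0.le, ?_, htu, ?_⟩
    · rw [hA]; gcongr; linarith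
    · have hlow : ∀ i ∈ Finset.range k, F ((t - i * R N ρ) / ρ) = 1 := by
        intro i hi
        apply hgt
        rw [lt_div_iff₀ hρ0]
        have : (i : ℝ) + 1 ≤ k := by exact_mod_cast Finset.mem_range.1 hi
        have := mul_le_mul_of_nonneg_right this hR.le
        linarith
      have hhigh : ∀ i ∈ Finset.Ico (k + 1) N, F ((t - i * R N ρ) / ρ) = 0 := by
        intro i hi
        apply hneg
        apply div_neg_of_neg_of_pos _ hρ0
        have : (k : ℝ) + 1 ≤ i := by exact_mod_cast (Finset.mem_Ico.1 hi).1
        have := mul_le_mul_of_nonneg_right this hR.le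
        linarith
      rw [hF t, ← Finset.sum_range_add_sum_Ico _ (Nat.succ_le_of_lt hkN), Finset.sum_range_succ,
        Finset.sum_congr rfl hlow, Finset.sum_congr rfl hhigh]
      simp
      ring
  have hscale : ∀ x, 0 ≤ x → (ρ * x) ^ s = x ^ s / N := by
    intro x hx
    rw [Real.mul_rpow hρ0.le hx, hρs]; ring
  have hNs : (((N : ℝ) - 1) * A + 1) ^ s = ((N : ℝ) - 1) + 1 := by
    have h1 := hscale (((N : ℝ) - 1) * A + 1) (by positivity)
    have : ρ * (((N : ℝ) - 1) * A + 1) = 1 := by linear_combination ((N : ℝ) - 1) * hAρ + hRN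
    rw [this, Real.one_rpow] at h1
    field_simp at h1
    linarith
  have lim : Tendsto (fun n : ℕ => (1 / (N : ℝ)) ^ n) atTop (𝓝 0) :=
    tendsto_pow_atTop_nhds_zero_of_lt_one (by positivity)
      (by rw [div_lt_one (by positivity)]; linarith)
  have up : ∀ n : ℕ, ∀ x, 0 ≤ x → F x ≤ x ^ s + (1 / (N : ℝ)) ^ n := by
    intro n
    induction n with
    | zero =>
      intro x hx
      have := Real.rpow_nonneg hx s
      have := hle1 x
      simp only [pow_zero]; linarith
    | succ n ih =>
      intro x hx
      have hp : 0 < (1 / (N : ℝ)) ^ n := by positivity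
      rcases le_or_gt x 1 with hx1 | hx1
      · obtain ⟨k, u, hk, hu0, huA, hxe, hFe⟩ := key x hx hx1
        have hk' : (k : ℝ) ≤ (N : ℝ) - 1 := by
          have : (k : ℝ) + 1 ≤ N := by exact_mod_cast hk
          linarith
        have hmain : k + F u ≤ (k * A + u) ^ s + (1 / (N : ℝ)) ^ n := by
          rcases le_or_gt u 1 with hu1 | hu1
          · have := upper_ineq _ hN1 A s (by linarith) hs0 hs1 hNs k u (by positivity) hk' hu0 hu1
            have := ih u hu0
            linarith
          · have h1 := upper_ineq _ hN1 A s (by linarith) hs0 hs1 hNs k 1 (by positivity) hk'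
              zero_le_one le_rfl
            rw [Real.one_rpow] at h1
            have h2 : ((k : ℝ) * A + 1) ^ s ≤ (k * A + u) ^ s :=
              Real.rpow_le_rpow (by positivity) (by linarith) hs0.le
            have := hle1 u
            linarith
        rw [hFe, hxe, hscale _ (by positivity), pow_succ, mul_one_div, ← add_div]
        gcongr
      · have := Real.one_le_rpow hx1.le hs0.le
        have := hle1 x
        have : 0 < (1 / (N : ℝ)) ^ (n + 1) := by positivity
        linarith
  have low : ∀ n : ℕ, ∀ x, 0 ≤ x → x ≤ A → (x / A) ^ s ≤ F x + (1 / (N : ℝ)) ^ n := by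
    intro n
    have hA0 : 0 < A := by linarith
    have le1 : ∀ x, 0 ≤ x → x ≤ A → (x / A) ^ s ≤ 1 := fun x h1 h2 =>
      Real.rpow_le_one (by positivity) ((div_le_one hA0).2 h2) hs0.le
    induction n with
    | zero =>
      intro x hx hxA
      have := hnn x
      have := le1 x hx hxA
      simp only [pow_zero]; linarith
    | succ n ih =>
      intro x hx hxA
      rcases le_or_gt x 1 with hx1 | hx1
      · obtain ⟨k, u, hk, hu0, huA, hxe, hFe⟩ := key x hx hx1
        have h1 : ((k : ℝ) + u / A) ^ s ≤ (k : ℝ) ^ s + (u / A) ^ s :=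
          Real.rpow_add_le_add_rpow (by positivity) (by positivity) hs0.le hs1
        have h2 : (k : ℝ) ^ s ≤ k := by
          rcases Nat.eq_zero_or_pos k with h | h
          · rw [h]; simp [Real.zero_rpow hs0.ne']
          · have : (1 : ℝ) ≤ k := by exact_mod_cast h
            calc (k : ℝ) ^ s ≤ (k : ℝ) ^ (1 : ℝ) := Real.rpow_le_rpow_of_exponent_le this hs1
              _ = k := Real.rpow_one _
        have h3 := ih u hu0 huA
        have e : x / A = ρ * (k + u / A) := by rw [hxe]; field_simp
        rw [hFe, e, hscale _ (by positivity), pow_succ, mul_one_div, ← add_div]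
        gcongr
        linarith
      · have := hgt x hx1
        have := le1 x hx hxA
        have : 0 < (1 / (N : ℝ)) ^ (n + 1) := by positivity
        linarith
  constructor
  · have e : (ρ / R N ρ) ^ s * t ^ s = (t / A) ^ s := by
      rw [← Real.mul_rpow (by positivity) ht.1]
      congr 1
      rw [hA]; field_simp
    rw [e]
    have := ge_of_tendsto' (lim.const_add (F t)) (fun n => low n t ht.1 (by linarith [ht.2]))
    simpa using this
  · have := ge_of_tendsto' (lim.const_add (t ^ s)) (fun n => up n t ht.1)
    simpa using this

/-- Lemma 2.2: bounds for `μ([0,t])` and `μ([t,1])`. -/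
theorem measure_interval_bounds (N : ℕ) (hN : 2 ≤ N) (ρ : ℝ) (hρ0 : 0 < ρ)
    (hρ1 : ρ ≤ 1 / (N : ℝ) ^ 2) (s : ℝ) (hs : s = -Real.log N / Real.log ρ)
    (μ : Measure ℝ) (hprob : IsProbabilityMeasure μ) (hss : IsSelfSimilar N ρ μ)
    (t : ℝ) (ht : t ∈ Icc (0 : ℝ) 1) :
    (ρ / R N ρ) ^ s * t ^ s ≤ (μ (Icc 0 t)).toReal ∧
    (μ (Icc 0 t)).toReal ≤ t ^ s ∧
    (ρ / R N ρ) ^ s * (1 - t) ^ s ≤ (μ (Icc t 1)).toReal ∧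
    (μ (Icc t 1)).toReal ≤ (1 - t) ^ s := by
  obtain ⟨h1, h2⟩ := half_bounds N hN ρ hρ0 hρ1 s hs μ hprob hss t ht
  have hm : Measurable (fun x : ℝ => 1 - x) := by fun_prop
  have ht' : 1 - t ∈ Icc (0 : ℝ) 1 := ⟨by linarith [ht.2], by linarith [ht.1]⟩
  obtain ⟨h3, h4⟩ := half_bounds N hN ρ hρ0 hρ1 s hs (μ.map (fun x : ℝ => 1 - x))
    (Measure.isProbabilityMeasure_map hm.aemeasurable) (reflect_ss N hN ρ μ hss) (1 - t) ht'
  have e : (fun x : ℝ => 1 - x) ⁻¹' (Icc 0 (1 - t)) = Icc t 1 := by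
    ext x; simp only [mem_preimage, mem_Icc]
    constructor <;> rintro ⟨a, b⟩ <;> constructor <;> linarith
  rw [Measure.map_apply hm measurableSet_Icc, e] at h3 h4
  exact ⟨h1, h2, h3, h4⟩

end HomogeneousCantorDensity
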